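/- arXiv:2507.15848 — 3 statements merged into one kernel-verified Lean document; each statement's English description precedes it below -/
import Mathlib

section
/- Let u, v be Hilbert–Schmidt operators (or elements of a Hilbert tensor product) with singular value sequences (σ_k(u)) and (σ_k(v)) in nonincreasing order. Then ‖u − v‖² ≥ ∑_{k=1}^∞ |σ_k(u) − σ_k(v)|², where ‖·‖ is the Hilbert–Schmidt (Frobenius) norm. -/
/-- Weighted sums against an antitone sequence are maximised by concentrating mass at the start. -/
theorem mirsky_aux1 (t : ℕ → ℝ) (ht : Antitone t) (ht0 : ∀ k, 0 ≤ t k) (N m : ℕ) (hm : m ≤ N)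
    (w : ℕ → ℝ) (hw0 : ∀ j, 0 ≤ w j) (hw1 : ∀ j, w j ≤ 1)
    (hws : ∑ j ∈ Finset.range N, w j ≤ m) :
    ∑ j ∈ Finset.range N, t j * w j ≤ ∑ j ∈ Finset.range m, t j := by
  have h1 : ∑ j ∈ Finset.range N, (t j - t m) * w j ≤ ∑ j ∈ Finset.range m, (t j - t m) := by
    rw [← Finset.sum_range_add_sum_Ico _ hm]
    have h2 : ∑ j ∈ Finset.Ico m N, (t j - t m) * w j ≤ 0 := by
      apply Finset.sum_nonpos
      intro j hj
      have := ht (Finset.mem_Ico.1 hj).1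
      exact mul_nonpos_of_nonpos_of_nonneg (by linarith) (hw0 j)
    have h3 : ∑ j ∈ Finset.range m, (t j - t m) * w j ≤ ∑ j ∈ Finset.range m, (t j - t m) := by
      apply Finset.sum_le_sum
      intro j hj
      have := ht (Finset.mem_range.1 hj).le
      nlinarith [hw1 j]
    linarith
  have h4 : ∑ j ∈ Finset.range N, (t j - t m) * w j
      = ∑ j ∈ Finset.range N, t j * w j - t m * ∑ j ∈ Finset.range N, w j := by
    rw [Finset.mul_sum, ← Finset.sum_sub_distrib]
    exact Finset.sum_congr rfl fun j _ => by ring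
  have h5 : ∑ j ∈ Finset.range m, (t j - t m) = ∑ j ∈ Finset.range m, t j - m * t m := by
    simp [Finset.sum_sub_distrib]
  have h6 := mul_le_mul_of_nonneg_left hws (ht0 m)
  linarith

/-- Abel summation: nonnegative partial sums stay nonnegative under antitone weights. -/
theorem mirsky_aux2 (s y : ℕ → ℝ) (hs : Antitone s) (N : ℕ)
    (hy : ∀ m ≤ N, 0 ≤ ∑ k ∈ Finset.range m, y k) :
    ∀ m ≤ N, s m * ∑ k ∈ Finset.range m, y k ≤ ∑ k ∈ Finset.range m, s k * y k := by
  intro m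
  induction m with
  | zero => simp
  | succ m ih =>
    intro hm
    have h1 := ih (by omega)
    have h2 := mul_le_mul_of_nonneg_right (hs (Nat.le_succ m)) (hy (m + 1) hm)
    rw [Finset.sum_range_succ] at h2 ⊢
    rw [Finset.sum_range_succ]
    simp only [Nat.succ_eq_add_one] at h2
    nlinarith

/-- Rearrangement inequality for doubly substochastic matrices. -/
theorem mirsky_aux3 (s t : ℕ → ℝ) (hs : Antitone s) (hs0 : ∀ k, 0 ≤ s k)
    (ht : Antitone t) (ht0 : ∀ k, 0 ≤ t k) (d : ℕ → ℕ → ℝ) (hd : ∀ k j, 0 ≤ d k j)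
    (hr : ∀ k n, ∑ j ∈ Finset.range n, d k j ≤ 1)
    (hc : ∀ j n, ∑ k ∈ Finset.range n, d k j ≤ 1) (N : ℕ) :
    ∑ k ∈ Finset.range N, ∑ j ∈ Finset.range N, s k * t j * d k j
      ≤ ∑ k ∈ Finset.range N, s k * t k := by
  have hy : ∀ m ≤ N, 0 ≤ ∑ k ∈ Finset.range m, (t k - ∑ j ∈ Finset.range N, t j * d k j) := by
    intro m hm
    rw [Finset.sum_sub_distrib, Finset.sum_comm, sub_nonneg]
    simp_rw [← Finset.mul_sum]
    apply mirsky_aux1 t ht ht0 N m hm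
    · intro j; exact Finset.sum_nonneg fun k _ => hd k j
    · intro j; exact hc j m
    · rw [Finset.sum_comm]
      refine (Finset.sum_le_sum fun k _ => hr k N).trans ?_
      simp
  have h1 := mirsky_aux2 s _ hs N hy N le_rfl
  have h2 := (mul_nonneg (hs0 N) (hy N le_rfl)).trans h1
  simp_rw [mul_sub, Finset.sum_sub_distrib, Finset.mul_sum, ← mul_assoc] at h2
  linarith

/-- The rank one operator `x ↦ ⟪e, x⟫ f` as an element of `ℓ²(ι, F)`. -/
theorem mirsky_rankOne {E F : Type*}
    [NormedAddCommGroup E] [InnerProductSpace ℂ E]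
    [NormedAddCommGroup F] [InnerProductSpace ℂ F]
    {ι : Type*} (b : HilbertBasis ι ℂ E) :
    ∃ T : E → F → lp (fun _ : ι => F) 2, (∀ e f i, T e f i = inner ℂ e (b i) • f) ∧
      ∀ e f e' f', inner ℂ (T e f) (T e' f') = inner ℂ e' e * inner ℂ f f' := by
  have hmem : ∀ (e : E) (f : F), Memℓp (E := fun _ : ι => F) (fun i => inner ℂ e (b i) • f) 2 := by
    intro e f
    apply memℓp_gen
    have h := (lp.memℓp (b.repr e)).summable (by norm_num)
    have h2 := h.mul_right (‖f‖ ^ 2)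
    refine h2.congr fun i => ?_
    rw [b.repr_apply_apply, norm_smul, ← norm_inner_symm e (b i)]
    norm_num [mul_pow]
  refine ⟨fun e f => ⟨_, hmem e f⟩, fun e f i => rfl, fun e f e' f' => ?_⟩
  rw [lp.inner_eq_tsum, ← b.tsum_inner_mul_inner e' e, ← tsum_mul_right]
  refine tsum_congr fun i => ?_
  change inner ℂ (inner ℂ e (b i) • f) (inner ℂ e' (b i) • f') = _
  rw [inner_smul_left, inner_smul_right, inner_conj_symm]
  ring

theorem mirsky_orthonormal {E F H : Type*}
    [NormedAddCommGroup E] [InnerProductSpace ℂ E]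
    [NormedAddCommGroup F] [InnerProductSpace ℂ F]
    [NormedAddCommGroup H] [InnerProductSpace ℂ H] (T : E → F → H)
    (hT : ∀ e f e' f', inner ℂ (T e f) (T e' f') = inner ℂ e' e * inner ℂ f f')
    (e : ℕ → E) (f : ℕ → F) (he : Orthonormal ℂ e) (hf : Orthonormal ℂ f) :
    Orthonormal ℂ (fun k => T (e k) (f k)) := by
  rw [orthonormal_iff_ite] at *
  intro i j
  rw [hT, he, hf]
  by_cases h : i = j <;> simp [h, eq_comm]

theorem mirsky_norm_sq {H : Type*}
    [NormedAddCommGroup H] [InnerProductSpace ℂ H] (T : ℕ → H) (hT : Orthonormal ℂ T)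
    (σ : ℕ → ℝ) (N : ℕ) :
    ‖∑ k ∈ Finset.range N, (σ k : ℂ) • T k‖ ^ 2 = ∑ k ∈ Finset.range N, σ k ^ 2 := by
  rw [← inner_self_eq_norm_sq (𝕜 := ℂ), hT.inner_sum]
  simp [← Complex.ofReal_mul, sq]

theorem mirsky_summable {H : Type*}
    [NormedAddCommGroup H] [InnerProductSpace ℂ H] [CompleteSpace H]
    (T : ℕ → H) (hT : Orthonormal ℂ T) (σ : ℕ → ℝ) (hσ : Summable fun k => σ k ^ 2) :
    Summable fun k => (σ k : ℂ) • T k := by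
  have := (hT.orthogonalFamily.summable_iff_norm_sq_summable (fun k => (σ k : ℂ))).2
    (by simpa using hσ)
  simpa using this

theorem mirsky_bessel {E : Type*}
    [NormedAddCommGroup E] [InnerProductSpace ℂ E] (e : ℕ → E) (he : Orthonormal ℂ e)
    (x : E) (hx : ‖x‖ = 1) (n : ℕ) : ∑ j ∈ Finset.range n, ‖(inner ℂ (e j) x : ℂ)‖ ^ 2 ≤ 1 := by
  simpa [hx] using he.sum_inner_products_le x (s := Finset.range n)

/-- Finite-rank Mirsky inequality. -/
theorem mirsky_finite {E F H : Type*}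
    [NormedAddCommGroup E] [InnerProductSpace ℂ E]
    [NormedAddCommGroup F] [InnerProductSpace ℂ F]
    [NormedAddCommGroup H] [InnerProductSpace ℂ H] (T : E → F → H)
    (hT : ∀ e f e' f', inner ℂ (T e f) (T e' f') = inner ℂ e' e * inner ℂ f f')
    (σu σv : ℕ → ℝ) (eu ev : ℕ → E) (fu fv : ℕ → F)
    (heu : Orthonormal ℂ eu) (hfu : Orthonormal ℂ fu)
    (hev : Orthonormal ℂ ev) (hfv : Orthonormal ℂ fv)
    (hσu : Antitone σu) (hσu0 : ∀ k, 0 ≤ σu k)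
    (hσv : Antitone σv) (hσv0 : ∀ k, 0 ≤ σv k) (N : ℕ) :
    ∑ k ∈ Finset.range N, (σu k - σv k) ^ 2 ≤
      ‖∑ k ∈ Finset.range N, (σu k : ℂ) • T (eu k) (fu k)
        - ∑ k ∈ Finset.range N, (σv k : ℂ) • T (ev k) (fv k)‖ ^ 2 := by
  rw [@norm_sub_sq ℂ, mirsky_norm_sq _ (mirsky_orthonormal T hT eu fu heu hfu),
    mirsky_norm_sq _ (mirsky_orthonormal T hT ev fv hev hfv)]
  have key := mirsky_aux3 σu σv hσu hσu0 hσv hσv0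
    (fun k j => (‖(inner ℂ (ev j) (eu k) : ℂ)‖ ^ 2 + ‖(inner ℂ (fu k) (fv j) : ℂ)‖ ^ 2) / 2)
    (fun k j => by positivity)
    (fun k n => by
      have h1 := mirsky_bessel ev hev (eu k) (heu.1 k) n
      have h2 := mirsky_bessel fv hfv (fu k) (hfu.1 k) n
      simp_rw [norm_inner_symm (fv _)] at h2
      rw [← Finset.sum_div, Finset.sum_add_distrib]
      linarith)
    (fun j n => by
      have h1 := mirsky_bessel eu heu (ev j) (hev.1 j) n
      have h2 := mirsky_bessel fu hfu (fv j) (hfv.1 j) n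
      simp_rw [norm_inner_symm (eu _)] at h1
      rw [← Finset.sum_div, Finset.sum_add_distrib]
      linarith) N
  have hre : RCLike.re (inner ℂ (∑ k ∈ Finset.range N, (σu k : ℂ) • T (eu k) (fu k))
      (∑ k ∈ Finset.range N, (σv k : ℂ) • T (ev k) (fv k)))
      ≤ ∑ k ∈ Finset.range N, σu k * σv k := by
    refine le_trans ?_ key
    simp_rw [sum_inner, inner_sum, map_sum]
    refine Finset.sum_le_sum fun k _ => Finset.sum_le_sum fun j _ => ?_
    rw [inner_smul_left, inner_smul_right, hT, Complex.conj_ofReal, ← mul_assoc,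
      ← Complex.ofReal_mul]
    refine (RCLike.re_le_norm _).trans ?_
    have h0 := mul_nonneg (hσu0 k) (hσv0 j)
    rw [norm_mul, norm_mul, Complex.norm_real, Real.norm_of_nonneg h0]
    refine mul_le_mul_of_nonneg_left ?_ h0
    nlinarith [sq_nonneg (‖(inner ℂ (ev j) (eu k) : ℂ)‖ - ‖(inner ℂ (fu k) (fv j) : ℂ)‖)]
  have hexp : ∑ k ∈ Finset.range N, (σu k - σv k) ^ 2 = ∑ k ∈ Finset.range N, σu k ^ 2
      - 2 * ∑ k ∈ Finset.range N, σu k * σv k + ∑ k ∈ Finset.range N, σv k ^ 2 := by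
    rw [Finset.mul_sum, ← Finset.sum_sub_distrib, ← Finset.sum_add_distrib]
    exact Finset.sum_congr rfl fun k _ => by ring
  linarith

open scoped ComplexInnerProductSpace in
/-- Mirsky inequality for Hilbert–Schmidt operators: if `u, v : E →L[ℂ] F` have singular
value decompositions with nonincreasing nonnegative singular values `σu, σv`, then the
squared Hilbert–Schmidt distance (computed in any Hilbert basis `b` of `E`) dominates the
ℓ² distance of the singular value sequences. -/
theorem stmt_2 {E F : Type*}
    [NormedAddCommGroup E] [InnerProductSpace ℂ E] [CompleteSpace E]
    [NormedAddCommGroup F] [InnerProductSpace ℂ F] [CompleteSpace F]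
    (u v : E →L[ℂ] F) (σu σv : ℕ → ℝ)
    (eu ev : ℕ → E) (fu fv : ℕ → F)
    (heu : Orthonormal ℂ eu) (hfu : Orthonormal ℂ fu)
    (hev : Orthonormal ℂ ev) (hfv : Orthonormal ℂ fv)
    (hσu : Antitone σu) (hσu0 : ∀ k, 0 ≤ σu k)
    (hσv : Antitone σv) (hσv0 : ∀ k, 0 ≤ σv k)
    (hσu2 : Summable (fun k => σu k ^ 2)) (hσv2 : Summable (fun k => σv k ^ 2))
    (hu : ∀ x, u x = ∑' k, (σu k : ℂ) • (⟪eu k, x⟫ • fu k))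
    (hv : ∀ x, v x = ∑' k, (σv k : ℂ) • (⟪ev k, x⟫ • fv k))
    {ι : Type*} (b : HilbertBasis ι ℂ E)
    (hHS : Summable (fun i => ‖u (b i) - v (b i)‖ ^ 2)) :
    ∑' k, (σu k - σv k) ^ 2 ≤ ∑' i, ‖u (b i) - v (b i)‖ ^ 2 := by
  obtain ⟨T, hTa, hT⟩ := mirsky_rankOne (F := F) b
  have hU := (mirsky_summable _ (mirsky_orthonormal T hT eu fu heu hfu) σu hσu2).hasSum
  have hV := (mirsky_summable _ (mirsky_orthonormal T hT ev fv hev hfv) σv hσv2).hasSum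
  set U := ∑' k, (σu k : ℂ) • T (eu k) (fu k)
  set V := ∑' k, (σv k : ℂ) • T (ev k) (fv k)
  have hUi : ∀ i, U i = u (b i) := by
    intro i
    have h := hU.mapL (lp.evalCLM ℂ (fun _ : ι => F) 2 i)
    rw [hu]
    refine Eq.trans h.tsum_eq.symm ?_
    refine tsum_congr fun k => ?_
    rw [map_smul, ← hTa]
    rfl
  have hVi : ∀ i, V i = v (b i) := by
    intro i
    have h := hV.mapL (lp.evalCLM ℂ (fun _ : ι => F) 2 i)
    rw [hv]
    refine Eq.trans h.tsum_eq.symm ?_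
    refine tsum_congr fun k => ?_
    rw [map_smul, ← hTa]
    rfl
  have hnorm : ‖U - V‖ ^ 2 = ∑' i, ‖u (b i) - v (b i)‖ ^ 2 := by
    have h := lp.norm_rpow_eq_tsum (p := 2) (by norm_num) (U - V)
    simpa [hUi, hVi] using h
  rw [← hnorm]
  have hlim := ((hU.tendsto_sum_nat.sub hV.tendsto_sum_nat).norm).pow 2
  have hsum : Summable fun k => (σu k - σv k) ^ 2 := by
    refine Summable.of_nonneg_of_le (fun k => sq_nonneg _) (fun k => ?_) (hσu2.add hσv2)
    nlinarith [mul_nonneg (hσu0 k) (hσv0 k)]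
  exact le_of_tendsto_of_tendsto' hsum.hasSum.tendsto_sum_nat hlim fun N =>
    mirsky_finite T hT σu σv eu ev fu fv heu hfu hev hfv hσu hσu0 hσv hσv0 N
end

section
/- Let g ∈ C^J([0,h]; H) with values in a Hilbert space H, let t_1 < … < t_J be the Gauss–Legendre nodes on [0,h] with Lagrange basis ℓ_m, and let p(s) = ∑_{m=1}^J g(t_m) ℓ_m(s). Then for every t ∈ [0,h], ‖∫_0^t (g(s) − p(s)) ds‖ ≤ (J! / (√(2J+1)·(2J)!)) · max_{s∈[0,h]} ‖g^{(J)}(s)‖ · h^{J+1}. -/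
lemma iter_deriv_monic (Z : Polynomial ℝ) (hZm : Z.Monic) (J : ℕ) (hZd : Z.natDegree = J) :
    Polynomial.derivative^[J] Z = Polynomial.C (J.factorial : ℝ) := by
  ext m
  rw [Polynomial.coeff_iterate_derivative, Polynomial.coeff_C]
  split_ifs with hm
  · subst hm
    have : Z.coeff J = 1 := by rw [← hZd]; exact hZm
    simp [this, Nat.descFactorial_self]
  · rw [Polynomial.coeff_eq_zero_of_natDegree_lt (by omega), smul_zero]

lemma rolle_chain (a b : ℝ) (n : ℕ) : ∀ (F : ℕ → ℝ → ℝ)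
    (_ : ∀ k < n, ∀ x ∈ Set.Icc a b, HasDerivWithinAt (F k) (F (k+1) x) (Set.Icc a b) x)
    (x : Fin (n+1) → ℝ) (_ : StrictMono x) (_ : ∀ i, x i ∈ Set.Icc a b)
    (_ : ∀ i, F 0 (x i) = 0), ∃ ξ ∈ Set.Icc a b, F n ξ = 0 := by
  induction n with
  | zero => intro F _ x _ hm hz; exact ⟨x 0, hm 0, hz 0⟩
  | succ n ih =>
    intro F hd x hx hm hz
    have key : ∀ i : Fin (n+1), ∃ y ∈ Set.Ioo (x i.castSucc) (x i.succ), F 1 y = 0 := by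
      intro i
      apply exists_hasDerivAt_eq_zero (f := F 0) (hx (Fin.castSucc_lt_succ))
      · intro y hy
        have hy' : y ∈ Set.Icc a b := ⟨(hm _).1.trans hy.1, hy.2.trans (hm _).2⟩
        exact ((hd 0 (Nat.succ_pos n) y hy').continuousWithinAt).mono
          (Set.Icc_subset_Icc (hm _).1 (hm _).2)
      · rw [hz, hz]
      · intro y hy
        have hy' : y ∈ Set.Ioo a b := ⟨(hm _).1.trans_lt hy.1, hy.2.trans_le (hm _).2⟩
        exact (hd 0 (Nat.succ_pos n) y (Set.Ioo_subset_Icc_self hy')).hasDerivAt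
          (Icc_mem_nhds hy'.1 hy'.2)
    choose y hy hy0 using key
    refine ih (fun k => F (k+1)) (fun k hk => hd (k+1) (by omega)) y ?_ ?_ hy0
    · rw [Fin.strictMono_iff_lt_succ]
      intro i
      have h1 := (hy i.castSucc).2
      have h2 := (hy i.succ).1
      rw [← Fin.succ_castSucc] at h2
      exact h1.trans h2
    · intro i
      exact ⟨(hm _).1.trans (hy i).1.le, (hy i).2.le.trans (hm _).2⟩

lemma interp_bound {H : Type*} [NormedAddCommGroup H] [InnerProductSpace ℝ H]
    (J : ℕ) (h : ℝ) (hh : 0 < h)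
    (t : Fin J → ℝ) (ht : StrictMono t) (htmem : ∀ j, t j ∈ Set.Icc (0 : ℝ) h)
    (L : Fin J → ℝ → ℝ)
    (hL : ∀ m s, L m s = ∏ j ∈ Finset.univ.erase m, (s - t j) / (t m - t j))
    (g : ℝ → H) (hg : ContDiffOn ℝ (J : ℕ) g (Set.Icc 0 h))
    (M : ℝ)
    (hM : ∀ s ∈ Set.Icc (0 : ℝ) h, ‖iteratedDerivWithin J g (Set.Icc 0 h) s‖ ≤ M)
    (p : ℝ → H) (hp : ∀ s, p s = ∑ m, L m s • g (t m))
    (s : ℝ) (hs : s ∈ Set.Icc (0 : ℝ) h) :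
    ‖g s - p s‖ ≤ |(Lagrange.nodal Finset.univ t).eval s| * (M / J.factorial) := by
  classical
  have hJf : (0:ℝ) < J.factorial := by positivity
  have hM0 : 0 ≤ M := (norm_nonneg _).trans (hM s hs)
  set v : H := g s - p s with hv
  set P : Polynomial ℝ := Lagrange.interpolate Finset.univ t (fun m => inner ℝ v (g (t m))) with hP
  have hPeval : ∀ x, P.eval x = inner ℝ v (p x) := by
    intro x
    rw [hP, Lagrange.interpolate_apply, Polynomial.eval_finsetSum, hp, inner_sum]
    refine Finset.sum_congr rfl fun m _ => ?_
    rw [inner_smul_right, hL, Lagrange.basis, Polynomial.eval_mul, Polynomial.eval_C,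
      Polynomial.eval_prod, mul_comm]
    congr 1
    refine Finset.prod_congr rfl fun j _ => ?_
    simp [Lagrange.basisDivisor, div_eq_inv_mul]
  have hPdeg : P.degree < J := by
    have := Lagrange.degree_interpolate_lt (s := Finset.univ) (v := t)
      (fun m => inner ℝ v (g (t m))) (ht.injective.injOn)
    rwa [Finset.card_univ, Fintype.card_fin] at this
  have hPt : ∀ m, P.eval (t m) = inner ℝ v (g (t m)) := fun m =>
    Lagrange.eval_interpolate_at_node _ (ht.injective.injOn) (Finset.mem_univ m)
  set Z : Polynomial ℝ := Lagrange.nodal Finset.univ t with hZ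
  have hZt : ∀ m, Z.eval (t m) = 0 := fun m => Lagrange.eval_nodal_at_node (Finset.mem_univ m)
  have hZm : Z.Monic := Lagrange.nodal_monic
  have hZd : Z.natDegree = J := by simp [hZ, Lagrange.natDegree_nodal]
  by_cases hst : ∃ m, t m = s
  · obtain ⟨m, rfl⟩ := hst
    have h1 : inner ℝ v v = (0:ℝ) := by
      conv_lhs => rw [hv]
      rw [← hv]
      have : inner ℝ v (g (t m) - p (t m)) = (0:ℝ) := by
        rw [inner_sub_right, ← hPeval, hPt, sub_self]
      rwa [← hv] at this
    rw [inner_self_eq_zero] at h1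
    rw [h1, norm_zero]; positivity
  push Not at hst
  have hZs : Z.eval s ≠ 0 := by
    rw [hZ, Lagrange.eval_nodal]
    exact Finset.prod_ne_zero_iff.2 fun m _ => sub_ne_zero.2 (hst m).symm
  set c : ℝ := inner ℝ v v / Z.eval s with hc
  set Q : Polynomial ℝ := P + Polynomial.C c * Z with hQ
  have hu : UniqueDiffOn ℝ (Set.Icc 0 h) := uniqueDiffOn_Icc hh
  let F : ℕ → ℝ → ℝ := fun k x => inner ℝ v (iteratedDerivWithin k g (Set.Icc 0 h) x)
    - (Polynomial.derivative^[k] Q).eval x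
  have hd : ∀ k < J, ∀ x ∈ Set.Icc 0 h,
      HasDerivWithinAt (F k) (F (k+1) x) (Set.Icc 0 h) x := by
    intro k hk x hx
    have h1 : HasDerivWithinAt (iteratedDerivWithin k g (Set.Icc 0 h))
        (iteratedDerivWithin (k+1) g (Set.Icc 0 h) x) (Set.Icc 0 h) x := by
      rw [iteratedDerivWithin_succ]
      exact (hg.differentiableOn_iteratedDerivWithin (mod_cast hk) hu x hx).hasDerivWithinAt
    have h2 := ((hasDerivWithinAt_const x (Set.Icc 0 h) v).inner ℝ h1).sub
      ((Polynomial.derivative^[k] Q).hasDerivWithinAt x (Set.Icc 0 h))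
    simp only [inner_zero_left, add_zero] at h2
    simp only [F, Function.iterate_succ_apply']
    exact h2
  set S : Finset ℝ := insert s (Finset.univ.image t) with hS
  have hcard : S.card = J + 1 := by
    rw [hS, Finset.card_insert_of_notMem (by simpa using hst),
      Finset.card_image_of_injective _ ht.injective]
    simp
  have hSm : ∀ x ∈ S, x ∈ Set.Icc 0 h ∧ F 0 x = 0 := by
    intro x hx
    rw [hS, Finset.mem_insert, Finset.mem_image] at hx
    rcases hx with rfl | ⟨m, _, rfl⟩
    · refine ⟨hs, ?_⟩
      have : inner ℝ v v = inner ℝ v (g x) - inner ℝ v (p x) := by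
        rw [← inner_sub_right]
      simp only [F, iteratedDerivWithin_zero, Function.iterate_zero, id, hQ, Polynomial.eval_add,
        Polynomial.eval_mul, Polynomial.eval_C, hPeval, hc]
      rw [div_mul_cancel₀ _ hZs, this]; ring
    · refine ⟨htmem m, ?_⟩
      simp [F, hQ, hPt, hZt]
  obtain ⟨ξ, hξ, hξ0⟩ := rolle_chain 0 h J F hd (S.orderEmbOfFin hcard)
    (S.orderEmbOfFin hcard).strictMono
    (fun i => (hSm _ (S.orderEmbOfFin_mem hcard i)).1)
    (fun i => (hSm _ (S.orderEmbOfFin_mem hcard i)).2)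
  have hQJ : (Polynomial.derivative^[J] Q).eval ξ = c * J.factorial := by
    have hP0 : Polynomial.derivative^[J] P = 0 :=
      Polynomial.iterate_derivative_eq_zero_of_degree_lt hPdeg
    have hZ0 := iter_deriv_monic Z hZm J hZd
    rw [hQ, iterate_map_add, hP0, Polynomial.iterate_derivative_C_mul, hZ0]
    simp
  simp only [F, hQJ, hc] at hξ0
  have h3 : inner ℝ v v * J.factorial = Z.eval s * inner ℝ v (iteratedDerivWithin J g (Set.Icc 0 h) ξ) := by
    rw [sub_eq_zero] at hξ0
    rw [hξ0]; field_simp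
  rw [real_inner_self_eq_norm_sq] at h3
  have h4 : ‖v‖^2 * J.factorial ≤ |Z.eval s| * (‖v‖ * M) := by
    rw [h3]
    refine (le_abs_self _).trans ?_
    rw [abs_mul]
    gcongr
    exact (abs_real_inner_le_norm _ _).trans (by gcongr; exact hM ξ hξ)
  rcases (norm_nonneg v).eq_or_lt with h5 | h5
  · rw [← h5]; positivity
  · rw [mul_div_assoc', le_div_iff₀ hJf]
    exact le_of_mul_le_mul_left (by linarith) h5

lemma poly_ibp (h : ℝ) (W : Polynomial ℝ) (k : ℕ) : ∀ (A : Polynomial ℝ)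
    (_ : ∀ i < k, (Polynomial.derivative^[i] W).eval 0 = 0)
    (_ : ∀ i < k, (Polynomial.derivative^[i] W).eval h = 0),
    ∫ s in (0:ℝ)..h, A.eval s * (Polynomial.derivative^[k] W).eval s =
      (-1)^k * ∫ s in (0:ℝ)..h, (Polynomial.derivative^[k] A).eval s * W.eval s := by
  induction k with
  | zero => intro A _ _; simp
  | succ k ih =>
    intro A h0 h1
    have := intervalIntegral.integral_mul_deriv_eq_deriv_mul (a := 0) (b := h)
      (u := fun s => A.eval s) (v := fun s => (Polynomial.derivative^[k] W).eval s)
      (u' := fun s => (Polynomial.derivative A).eval s)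
      (v' := fun s => (Polynomial.derivative (Polynomial.derivative^[k] W)).eval s)
      (fun x _ => A.hasDerivAt x) (fun x _ => Polynomial.hasDerivAt _ x)
      ((Polynomial.continuous _).intervalIntegrable _ _)
      ((Polynomial.continuous _).intervalIntegrable _ _)
    rw [Function.iterate_succ_apply', this, h0 k (by omega), h1 k (by omega),
      ih (Polynomial.derivative A) (fun i hi => h0 i (by omega)) (fun i hi => h1 i (by omega)),
      Function.iterate_succ_apply]
    ring

lemma beta_int (h : ℝ) (b : ℕ) : ∀ a : ℕ, ∫ s in (0:ℝ)..h, s^a * (h - s)^b =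
    (a.factorial * b.factorial / (a+b+1).factorial : ℝ) * h^(a+b+1) := by
  induction b with
  | zero =>
    intro a
    simp [integral_pow, Nat.factorial_succ]
    field_simp
  | succ b ih =>
    intro a
    have := intervalIntegral.integral_mul_deriv_eq_deriv_mul (a := 0) (b := h)
      (u := fun s => (h - s)^(b+1)) (v := fun s => s^(a+1) / (a+1))
      (u' := fun s => - ((b+1) * (h - s)^b))
      (v' := fun s => s^a)
      (fun x _ => by
        have := ((hasDerivAt_id x).const_sub h).pow (b+1)
        refine this.congr_deriv ?_
        simp)
      (fun x _ => by
        have := (hasDerivAt_pow (a+1) x).div_const ((a:ℝ)+1)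
        refine this.congr_deriv ?_
        push_cast
        field_simp)
      ((by fun_prop : Continuous _).intervalIntegrable _ _)
      ((by fun_prop : Continuous _).intervalIntegrable _ _)
    simp only [mul_comm (_ ^ a)]
    rw [this]
    have h2 : ∀ s : ℝ, -((b + 1) * (h - s)^b) * (s^(a+1)/(a+1)) =
      (-((b+1)/(a+1)) : ℝ) * (s^(a+1) * (h-s)^b) := by intro s; ring
    simp only [h2]
    rw [intervalIntegral.integral_const_mul, ih]
    have e : a + 1 + b + 1 = a + (b+1) + 1 := by ring
    rw [e, Nat.factorial_succ a, Nat.factorial_succ b]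
    push_cast
    simp
    field_simp

lemma nodal_sq (J : ℕ) (hJ : 0 < J) (h : ℝ) (Z : Polynomial ℝ) (hZm : Z.Monic)
    (hZd : Z.natDegree = J)
    (horth : ∀ q : Polynomial ℝ, q.natDegree < J → ∫ s in (0:ℝ)..h, Z.eval s * q.eval s = 0) :
    ∫ s in (0:ℝ)..h, Z.eval s ^ 2 =
      h^(2*J+1) * J.factorial^4 / ((2*J+1) * (2*J).factorial^2) := by
  set W : Polynomial ℝ := (Polynomial.X * (Polynomial.X - Polynomial.C h))^J with hW
  have hBm : (Polynomial.X * (Polynomial.X - Polynomial.C h)).Monic :=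
    Polynomial.monic_X.mul (Polynomial.monic_X_sub_C h)
  have hWm : W.Monic := hBm.pow J
  have hWd : W.natDegree = 2 * J := by
    rw [hW, hBm.natDegree_pow, Polynomial.monic_X.natDegree_mul (Polynomial.monic_X_sub_C h),
      Polynomial.natDegree_X, Polynomial.natDegree_X_sub_C]; ring
  have hroot : ∀ i < J, Polynomial.X * (Polynomial.X - Polynomial.C h) ∣
      Polynomial.derivative^[i] W := fun i hi =>
    (dvd_pow_self _ (by omega)).trans (Polynomial.pow_sub_dvd_iterate_derivative_pow _ J i)
  have h0 : ∀ i < J, (Polynomial.derivative^[i] W).eval 0 = 0 := by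
    intro i hi
    obtain ⟨r, hr⟩ := hroot i hi
    rw [hr]; simp
  have h1 : ∀ i < J, (Polynomial.derivative^[i] W).eval h = 0 := by
    intro i hi
    obtain ⟨r, hr⟩ := hroot i hi
    rw [hr]; simp
  have hibp := poly_ibp h W J Z h0 h1
  rw [iter_deriv_monic Z hZm J hZd] at hibp
  have hWe : ∀ s, (Polynomial.C (J.factorial:ℝ)).eval s * W.eval s =
      ((J.factorial:ℝ) * (-1)^J) * (s^J * (h - s)^J) := by
    intro s
    rw [hW]
    simp only [Polynomial.eval_C, Polynomial.eval_pow, Polynomial.eval_mul, Polynomial.eval_X,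
      Polynomial.eval_sub]
    have : s * (s - h) = (-1) * (s * (h - s)) := by ring
    rw [this, mul_pow, mul_pow]; ring
  simp only [hWe] at hibp
  rw [intervalIntegral.integral_const_mul, beta_int] at hibp
  set c : ℝ := J.factorial / (2*J).factorial with hc
  set D := Polynomial.derivative^[J] W with hD
  have hdf : ((2*J).descFactorial J : ℝ) * J.factorial = (2*J).factorial := by
    have := Nat.factorial_mul_descFactorial (n := 2*J) (k := J) (by omega)
    have e : 2 * J - J = J := by omega
    rw [e] at this
    rw [mul_comm]; exact_mod_cast this
  have hDd : D.natDegree ≤ J := (Polynomial.natDegree_iterate_derivative W J).trans (by omega)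
  have hDc : c * D.coeff J = 1 := by
    rw [hD, Polynomial.coeff_iterate_derivative]
    have : W.coeff (J + J) = 1 := by
      rw [← two_mul, ← hWd]; exact hWm
    rw [this, ← two_mul, nsmul_eq_mul, mul_one, hc, div_mul_eq_mul_div, mul_comm, hdf]
    exact div_self (by positivity)
  have hlt : (Z - Polynomial.C c * D).natDegree < J := by
    have hle : (Z - Polynomial.C c * D).natDegree ≤ J :=
      (Polynomial.natDegree_sub_le _ _).trans
        (max_le hZd.le ((Polynomial.natDegree_C_mul_le _ _).trans hDd))
    refine lt_of_le_of_ne hle fun heq => ?_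
    have hz : (Z - Polynomial.C c * D).leadingCoeff = 0 := by
      have hZJ : Z.coeff J = 1 := by rw [← hZd]; exact hZm
      rw [Polynomial.leadingCoeff, heq, Polynomial.coeff_sub, Polynomial.coeff_C_mul, hDc, hZJ,
        sub_self]
    rw [Polynomial.leadingCoeff_eq_zero] at hz
    rw [hz, Polynomial.natDegree_zero] at heq
    omega
  have ho := horth _ hlt
  have hi : ∀ q : Polynomial ℝ, IntervalIntegrable (fun s => Z.eval s * q.eval s)
      MeasureTheory.volume 0 h := fun q =>
    (by fun_prop : Continuous _).intervalIntegrable _ _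
  have hsplit : ∫ s in (0:ℝ)..h, Z.eval s ^ 2 = c * ∫ s in (0:ℝ)..h, Z.eval s * D.eval s := by
    rw [← intervalIntegral.integral_const_mul, ← sub_eq_zero, ← ho,
      ← intervalIntegral.integral_sub]
    · congr 1; ext s; simp; ring
    · exact (by fun_prop : Continuous _).intervalIntegrable _ _
    · exact (by fun_prop : Continuous _).intervalIntegrable _ _
  rw [hsplit, hibp, hc, show J + J + 1 = 2 * J + 1 by ring, Nat.factorial_succ]
  have : ((-1:ℝ)^J)*(-1)^J = 1 := by rw [← mul_pow]; simp
  push_cast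
  field_simp
  linear_combination h^(2*J+1) * this

theorem stmt_11 {H : Type*} [NormedAddCommGroup H] [InnerProductSpace ℝ H] [CompleteSpace H]
    (J : ℕ) (hJ : 0 < J) (h : ℝ) (hh : 0 < h)
    (t : Fin J → ℝ) (ht : StrictMono t) (htmem : ∀ j, t j ∈ Set.Icc (0 : ℝ) h)
    (ω : Fin J → ℝ)
    (hexact : ∀ q : Polynomial ℝ, q.natDegree ≤ 2 * J - 1 →
      ∑ j, ω j * q.eval (t j) = ∫ s in (0 : ℝ)..h, q.eval s)
    (L : Fin J → ℝ → ℝ)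
    (hL : ∀ m s, L m s = ∏ j ∈ Finset.univ.erase m, (s - t j) / (t m - t j))
    (g : ℝ → H) (hg : ContDiffOn ℝ (J : ℕ) g (Set.Icc 0 h))
    (M : ℝ)
    (hM : ∀ s ∈ Set.Icc (0 : ℝ) h, ‖iteratedDerivWithin J g (Set.Icc 0 h) s‖ ≤ M)
    (p : ℝ → H) (hp : ∀ s, p s = ∑ m, L m s • g (t m))
    (τ : ℝ) (hτ : τ ∈ Set.Icc (0 : ℝ) h) :
    ‖∫ s in (0 : ℝ)..τ, (g s - p s)‖ ≤
      ((J.factorial : ℝ) / (Real.sqrt (2 * J + 1) * ((2 * J).factorial : ℝ))) *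
        M * h ^ (J + 1) := by
  set Z : Polynomial ℝ := Lagrange.nodal Finset.univ t with hZ
  have hZt : ∀ m, Z.eval (t m) = 0 := fun m => Lagrange.eval_nodal_at_node (Finset.mem_univ m)
  have hZm : Z.Monic := Lagrange.nodal_monic
  have hZd : Z.natDegree = J := by simp [hZ, Lagrange.natDegree_nodal]
  have hM0 : 0 ≤ M := (norm_nonneg _).trans (hM τ hτ)
  have hsq := nodal_sq J hJ h Z hZm hZd (by
    intro q hq
    have := hexact (Z * q) (Polynomial.natDegree_mul_le.trans (by omega))
    simp only [Polynomial.eval_mul, hZt, zero_mul, mul_zero, Finset.sum_const_zero] at this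
    exact this.symm)
  have hcont : Continuous fun s => |Z.eval s| := by fun_prop
  have step1 : ‖∫ s in (0 : ℝ)..τ, (g s - p s)‖ ≤
      ∫ s in (0:ℝ)..τ, |Z.eval s| * (M / J.factorial) := by
    apply intervalIntegral.norm_integral_le_of_norm_le hτ.1
    · refine Filter.Eventually.of_forall fun s hs => ?_
      exact interp_bound J h hh t ht htmem L hL g hg M hM p hp s ⟨hs.1.le, hs.2.trans hτ.2⟩
    · exact (hcont.mul continuous_const).intervalIntegrable _ _
  have step2 : ∫ s in (0:ℝ)..τ, |Z.eval s| ≤ ∫ s in (0:ℝ)..h, |Z.eval s| := by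
    apply intervalIntegral.integral_mono_interval le_rfl hτ.1 hτ.2
    · exact Filter.Eventually.of_forall fun s => abs_nonneg _
    · exact hcont.intervalIntegrable _ _
  set I := ∫ s in (0:ℝ)..h, |Z.eval s| with hI
  have hI0 : 0 ≤ I := intervalIntegral.integral_nonneg hh.le fun s _ => abs_nonneg _
  have cs : I^2 ≤ h * ∫ s in (0:ℝ)..h, Z.eval s ^ 2 := by
    have h1 : 0 ≤ ∫ s in (0:ℝ)..h, (h * |Z.eval s| - I)^2 :=
      intervalIntegral.integral_nonneg hh.le fun s _ => sq_nonneg _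
    have h2 : ∀ s, (h * |Z.eval s| - I)^2 = h^2 * Z.eval s^2 - (2*h*I) * |Z.eval s| + I^2 := by
      intro s; rw [← sq_abs (Z.eval s)]; ring
    simp only [h2] at h1
    rw [intervalIntegral.integral_add, intervalIntegral.integral_sub,
      intervalIntegral.integral_const_mul, intervalIntegral.integral_const_mul,
      intervalIntegral.integral_const, ← hI] at h1
    · simp only [sub_zero, smul_eq_mul] at h1
      refine le_of_mul_le_mul_left ?_ hh
      nlinarith
    all_goals exact (by fun_prop : Continuous _).intervalIntegrable _ _
  have hIb : I ≤ h^(J+1) * J.factorial^2 / (Real.sqrt (2*J+1) * (2*J).factorial) := by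
    refine le_of_sq_le_sq ?_ (by positivity)
    refine cs.trans (le_of_eq ?_)
    rw [hsq, div_pow, mul_pow, mul_pow, Real.sq_sqrt (by positivity)]
    field_simp
    ring
  rw [intervalIntegral.integral_mul_const] at step1
  calc _ ≤ _ := step1
    _ ≤ (h^(J+1) * J.factorial^2 / (Real.sqrt (2*J+1) * (2*J).factorial)) * (M / J.factorial) := by
      gcongr
      exact step2.trans hIb
    _ = _ := by field_simp
end

section
/- Let P = (p_{k,ℓ})_{k,ℓ ∈ I} be a doubly stochastic (infinite) matrix, i.e., p_{k,ℓ} ≥ 0 with ∑_ℓ p_{k,ℓ} = 1 for all k and ∑_k p_{k,ℓ} = 1 for all ℓ, and let (λ_k), (μ_k) be real ℓ² sequences indexed by I = ℤ \ {0} with λ_{−k} = −λ_k, μ_{−k} = −μ_k, λ_k ≥ λ_{k+1} ≥ 0 and μ_k ≥ μ_{k+1} ≥ 0 for k ≥ 1. Then ∑_{k,ℓ} p_{k,ℓ} (λ_k − μ_ℓ)² ≥ ∑_k (λ_k − μ_k)². -/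
/-- Dual potentials for the rearrangement inequality on `ℕ`. -/
lemma aux_potentials (a b : ℕ → ℝ) (ha : Antitone a) (hb : Antitone b)
    (ha0 : ∀ n, 0 ≤ a n) (hb0 : ∀ n, 0 ≤ b n) (hs : Summable fun n => a n * b n) :
    ∃ u v : ℕ → ℝ, (∀ k, 0 ≤ u k) ∧ (∀ k, 0 ≤ v k) ∧ (∀ k, u k + v k = a k * b k) ∧
      ∀ k l, a k * b l ≤ u k + v l := by
  have hc0 : ∀ j, 0 ≤ (a j - a (j+1)) * b j := fun j =>
    mul_nonneg (sub_nonneg.2 (ha (Nat.le_succ j))) (hb0 j)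
  have hd0 : ∀ j, 0 ≤ a (j+1) * (b j - b (j+1)) := fun j =>
    mul_nonneg (ha0 _) (sub_nonneg.2 (hb (Nat.le_succ j)))
  have hcd : ∀ j, (a j - a (j+1)) * b j + a (j+1) * (b j - b (j+1))
      = a j * b j - a (j+1) * b (j+1) := fun j => by ring
  have hw0 : ∀ j, 0 ≤ a j * b j := fun j => mul_nonneg (ha0 _) (hb0 _)
  have hc : Summable fun j => (a j - a (j+1)) * b j :=
    Summable.of_nonneg_of_le hc0
      (fun j => by linarith [hd0 j, hcd j, hw0 (j+1)]) hs
  have hd : Summable fun j => a (j+1) * (b j - b (j+1)) :=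
    Summable.of_nonneg_of_le hd0
      (fun j => by linarith [hc0 j, hcd j, hw0 (j+1)]) hs
  generalize hcdef : (fun j => (a j - a (j+1)) * b j) = c at hc
  generalize hddef : (fun j => a (j+1) * (b j - b (j+1))) = d at hd
  have hcj : ∀ j, c j = (a j - a (j+1)) * b j := fun j => by rw [← hcdef]
  have hdj : ∀ j, d j = a (j+1) * (b j - b (j+1)) := fun j => by rw [← hddef]
  have tail : ∀ (f : ℕ → ℝ), Summable f → ∀ k,
      ∑' j, f (j + k) = f k + ∑' j, f (j + (k+1)) := by
    intro f hf k
    have h := ((summable_nat_add_iff k).2 hf).tsum_eq_zero_add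
    rw [h]
    simp only [zero_add]
    congr 1
    exact tsum_congr fun j => by congr 1; omega
  obtain ⟨u, hu⟩ : ∃ u : ℕ → ℝ, ∀ k, u k = ∑' j, c (j + k) := ⟨_, fun _ => rfl⟩
  obtain ⟨v, hv⟩ : ∃ v : ℕ → ℝ, ∀ k, v k = ∑' j, d (j + k) := ⟨_, fun _ => rfl⟩
  have hurec : ∀ k, u k = c k + u (k+1) := fun k => by rw [hu, hu, tail c hc]
  have hvrec : ∀ k, v k = d k + v (k+1) := fun k => by rw [hv, hv, tail d hd]
  have huv : ∀ k, u k + v k = a k * b k := by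
    intro k
    rw [hu, hv, ← ((summable_nat_add_iff k).2 hc).tsum_add ((summable_nat_add_iff k).2 hd)]
    have h1 : ∀ j, c (j+k) + d (j+k)
        = a (j+k) * b (j+k) - a (j+(k+1)) * b (j+(k+1)) := fun j => by
      rw [hcj, hdj, hcd]; rfl
    rw [tsum_congr h1, ((summable_nat_add_iff (f := fun n => a n * b n) k).2 hs).tsum_sub
      ((summable_nat_add_iff (f := fun n => a n * b n) (k+1)).2 hs)]
    have := tail _ hs k
    linarith
  have hU : ∀ k e, (a k - a (k+e)) * b (k+e) + u (k+e) ≤ u k := by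
    intro k e
    induction e with
    | zero => simp
    | succ e ih =>
      have h1 := hurec (k+e)
      rw [hcj] at h1
      have h2 : 0 ≤ (a k - a (k+e+1)) * (b (k+e) - b (k+e+1)) :=
        mul_nonneg (sub_nonneg.2 (ha (by omega))) (sub_nonneg.2 (hb (by omega)))
      rw [← add_assoc]
      nlinarith
  have hV : ∀ k e, a (k+e) * (b k - b (k+e)) + v (k+e) ≤ v k := by
    intro k e
    induction e with
    | zero => simp
    | succ e ih =>
      have h1 := hvrec (k+e)
      rw [hdj] at h1
      have h2 : 0 ≤ (a (k+e) - a (k+e+1)) * (b k - b (k+e)) :=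
        mul_nonneg (sub_nonneg.2 (ha (by omega))) (sub_nonneg.2 (hb (by omega)))
      rw [← add_assoc]
      nlinarith
  refine ⟨u, v, fun k => ?_, fun k => ?_, huv, fun k l => ?_⟩
  · rw [hu]; exact tsum_nonneg fun j => by rw [hcj]; exact hc0 _
  · rw [hv]; exact tsum_nonneg fun j => by rw [hdj]; exact hd0 _
  · rcases le_total k l with h | h
    · obtain ⟨e, rfl⟩ := Nat.exists_eq_add_of_le h
      nlinarith [hU k e, huv (k+e)]
    · obtain ⟨e, rfl⟩ := Nat.exists_eq_add_of_le h
      nlinarith [hV l e, huv (l+e)]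

/-- Weighting a summable family by a matrix whose sections sum to one. -/
lemma aux_weight {ι : Type*} (p : ι → ι → ℝ) (hp0 : ∀ k l, 0 ≤ p k l)
    (hrow : ∀ k, HasSum (p k) 1) (f : ι → ℝ) (hf : Summable f) :
    HasSum (fun x : ι × ι => p x.1 x.2 * f x.1) (∑' k, f k) := by
  have hsum : Summable (fun x : ι × ι => p x.1 x.2 * f x.1) := by
    refine Summable.of_abs ?_
    have h0 : 0 ≤ fun x : ι × ι => |p x.1 x.2 * f x.1| := fun x => abs_nonneg _
    rw [summable_prod_of_nonneg h0]
    have h1 : ∀ k, HasSum (fun l => |p k l * f k|) |f k| := by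
      intro k
      have := (hrow k).mul_right |f k|
      simpa [abs_mul, abs_of_nonneg (hp0 _ _)] using this
    refine ⟨fun k => (h1 k).summable, ?_⟩
    simpa only [(h1 _).tsum_eq] using hf.abs
  have h2 := hsum.tsum_prod
  have h3 : ∀ k, ∑' l, p k l * f k = f k := fun k => by
    simpa using ((hrow k).mul_right (f k)).tsum_eq
  rw [tsum_congr h3] at h2
  exact h2 ▸ hsum.hasSum

/-- Doubly stochastic rearrangement inequality on `I = ℤ \ {0}`: if `P = (p k ℓ)` is
doubly stochastic, and `λ, μ` are antisymmetric ℓ² sequences (`λ₋ₖ = −λₖ`) that are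
nonnegative and nonincreasing on positive indices, then
`∑_{k,ℓ} p k ℓ (λ k − μ ℓ)² ≥ ∑_k (λ k − μ k)²`. -/
theorem stmt_14 (p : {k : ℤ // k ≠ 0} → {k : ℤ // k ≠ 0} → ℝ)
    (lam mu : {k : ℤ // k ≠ 0} → ℝ)
    (hp0 : ∀ k l, 0 ≤ p k l)
    (hrow : ∀ k, ∑' l, p k l = 1)
    (hcol : ∀ l, ∑' k, p k l = 1)
    (hlamanti : ∀ (k : ℤ) (hk : k ≠ 0),
      lam ⟨-k, neg_ne_zero.mpr hk⟩ = -lam ⟨k, hk⟩)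
    (hmuanti : ∀ (k : ℤ) (hk : k ≠ 0),
      mu ⟨-k, neg_ne_zero.mpr hk⟩ = -mu ⟨k, hk⟩)
    (hlampos : ∀ k : ℤ, (hk : 1 ≤ k) → 0 ≤ lam ⟨k, by omega⟩)
    (hmupos : ∀ k : ℤ, (hk : 1 ≤ k) → 0 ≤ mu ⟨k, by omega⟩)
    (hlammono : ∀ k : ℤ, (hk : 1 ≤ k) → lam ⟨k + 1, by omega⟩ ≤ lam ⟨k, by omega⟩)
    (hmumono : ∀ k : ℤ, (hk : 1 ≤ k) → mu ⟨k + 1, by omega⟩ ≤ mu ⟨k, by omega⟩)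
    (hlamsum : Summable (fun k => lam k ^ 2))
    (hmusum : Summable (fun k => mu k ^ 2)) :
    ∑' k, (lam k - mu k) ^ 2 ≤ ∑' k, ∑' l, p k l * (lam k - mu l) ^ 2 := by
  have hrow' : ∀ k, HasSum (p k) 1 := fun k => by
    have hs : Summable (p k) := by
      by_contra h
      have := hrow k
      rw [tsum_eq_zero_of_not_summable h] at this
      exact zero_ne_one this
    exact hrow k ▸ hs.hasSum
  have hcol' : ∀ l, HasSum (fun k => p k l) 1 := fun l => by
    have hs : Summable (fun k => p k l) := by
      by_contra h
      have := hcol l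
      rw [tsum_eq_zero_of_not_summable h] at this
      exact zero_ne_one this
    exact hcol l ▸ hs.hasSum
  have W1 := fun f hf => aux_weight p hp0 hrow' f hf
  have W2 : ∀ f : {k : ℤ // k ≠ 0} → ℝ, Summable f →
      HasSum (fun x : {k : ℤ // k ≠ 0} × {k : ℤ // k ≠ 0} => p x.1 x.2 * f x.2) (∑' k, f k) :=
    fun f hf => by
      have := aux_weight (fun l k => p k l) (fun l k => hp0 k l) hcol' f hf
      exact (Equiv.prodComm _ _).hasSum_iff.1 this
  have hlm : Summable fun k => lam k * mu k := by
    refine Summable.of_abs (Summable.of_nonneg_of_le (fun _ => abs_nonneg _) (fun k => ?_)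
      (hlamsum.add hmusum))
    rw [abs_le]
    constructor <;> nlinarith [sq_nonneg (lam k + mu k), sq_nonneg (lam k - mu k)]
  -- sequences on the naturals
  let e : ℕ → {k : ℤ // k ≠ 0} := fun n => ⟨(n : ℤ) + 1, by omega⟩
  have he : Function.Injective e := fun m n h => by
    have := congrArg Subtype.val h
    simp only [e] at this
    omega
  obtain ⟨u, v, hu0, hv0, huv, hle⟩ := aux_potentials (fun n => lam (e n)) (fun n => mu (e n))
    (antitone_nat_of_succ_le fun n => by
      simpa [e] using hlammono ((n : ℤ) + 1) (by omega))
    (antitone_nat_of_succ_le fun n => by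
      simpa [e] using hmumono ((n : ℤ) + 1) (by omega))
    (fun n => hlampos _ (by omega)) (fun n => hmupos _ (by omega))
    (hlm.comp_injective he)
  let r : {k : ℤ // k ≠ 0} → ℕ := fun k => k.1.natAbs - 1
  have hcase : ∀ k : {k : ℤ // k ≠ 0},
      (lam k = lam (e (r k)) ∧ mu k = mu (e (r k))) ∨
      (lam k = - lam (e (r k)) ∧ mu k = - mu (e (r k))) := by
    rintro ⟨k, hk⟩
    rcases lt_or_gt_of_ne hk with h | h
    · right
      have hh : e (r ⟨k, hk⟩) = ⟨-k, neg_ne_zero.mpr hk⟩ := by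
        apply Subtype.ext
        simp only [e, r]
        omega
      rw [hh, hlamanti k hk, hmuanti k hk]
      simp
    · left
      have hh : e (r ⟨k, hk⟩) = ⟨k, hk⟩ := by
        apply Subtype.ext
        simp only [e, r]
        omega
      rw [hh]
      simp
  have hl0 : ∀ n, 0 ≤ lam (e n) := fun n => hlampos _ (by omega)
  have hm0 : ∀ n, 0 ≤ mu (e n) := fun n => hmupos _ (by omega)
  have hUV : ∀ k, u (r k) + v (r k) = lam k * mu k := by
    intro k
    rw [huv]
    rcases hcase k with ⟨h1, h2⟩ | ⟨h1, h2⟩ <;> rw [h1, h2] <;> ring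
  have hUVle : ∀ k l, lam k * mu l ≤ u (r k) + v (r l) := by
    intro k l
    have h := hle (r k) (r l)
    have h' := mul_nonneg (hl0 (r k)) (hm0 (r l))
    rcases hcase k with ⟨h1, -⟩ | ⟨h1, -⟩ <;> rcases hcase l with ⟨-, h2⟩ | ⟨-, h2⟩ <;>
      rw [h1, h2] <;> (try simp only [neg_mul, mul_neg, neg_neg]) <;> linarith
  have hus : Summable fun k => u (r k) :=
    Summable.of_nonneg_of_le (fun k => hu0 _) (fun k => by linarith [hUV k, hv0 (r k)]) hlm
  have hvs : Summable fun k => v (r k) :=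
    Summable.of_nonneg_of_le (fun k => hv0 _) (fun k => by linarith [hUV k, hu0 (r k)]) hlm
  have hf : Summable fun k => lam k ^ 2 - 2 * u (r k) := hlamsum.sub (hus.mul_left 2)
  have hg : Summable fun k => mu k ^ 2 - 2 * v (r k) := hmusum.sub (hvs.mul_left 2)
  have H := (W1 _ hf).add (W2 _ hg)
  have hS : Summable fun x : {k : ℤ // k ≠ 0} × {k : ℤ // k ≠ 0} =>
      p x.1 x.2 * (lam x.1 - mu x.2) ^ 2 := by
    refine Summable.of_nonneg_of_le (fun x => mul_nonneg (hp0 _ _) (sq_nonneg _)) (fun x => ?_)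
      (((W1 _ hlamsum).summable.add (W2 _ hmusum).summable).mul_left 2)
    nlinarith [mul_nonneg (hp0 x.1 x.2) (sq_nonneg (lam x.1 + mu x.2))]
  rw [← hS.tsum_prod]
  have hL : ∑' k, (lam k - mu k) ^ 2
      = ∑' k, (lam k ^ 2 - 2 * u (r k)) + ∑' k, (mu k ^ 2 - 2 * v (r k)) := by
    rw [← hf.tsum_add hg]
    exact tsum_congr fun k => by linear_combination 2 * hUV k
  rw [hL, ← H.tsum_eq]
  refine H.summable.tsum_le_tsum (fun x => ?_) hS
  nlinarith [mul_nonneg (hp0 x.1 x.2) (sub_nonneg.2 (hUVle x.1 x.2))]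
end
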